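/- arXiv:2001.08643 — 5 statements merged into one kernel-verified Lean document; each statement's English description precedes it below -/
import Mathlib

section
/- Let M, L, N_T, N_R be positive integers and let p be an integer. Let d ∈ ℂ^M, a_T ∈ ℂ^{N_T}, a_R ∈ ℂ^{N_R}, and set A = a_R a_T^T ∈ ℂ^{N_R×N_T}. Let x ∈ ℂ^{L·N_T} and let X ∈ ℂ^{N_T×L} be the unique matrix with vec(X) = x; set X_p = X J_p. Then (d ⊗ J_p^T ⊗ A) x = (I_M ⊗ X_p^T ⊗ I_{N_R}) (d ⊗ a_T ⊗ a_R). -/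
open Matrix
open scoped Kronecker

/-- The `L × L` shift matrix `J_p`, with `J_p(i,j) = 1` iff `i - j + p = 0`. -/
noncomputable def shiftJ (L : ℕ) (p : ℤ) : Matrix (Fin L) (Fin L) ℂ :=
  fun i j => if ((i : ℤ) - (j : ℤ) + p = 0) then 1 else 0

/-- Kronecker product of two (column) vectors. -/
def vkron {m n : Type*} (u : m → ℂ) (v : n → ℂ) : m × n → ℂ :=
  fun q => u q.1 * v q.2

/-- The mixed-product property of the Kronecker product, for a matrix applied to a vector. -/
theorem kronecker_mulVec_vkron {l m n o : Type*} [Fintype m] [Fintype o]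
    (A : Matrix l m ℂ) (B : Matrix n o ℂ) (u : m → ℂ) (v : o → ℂ) :
    (A ⊗ₖ B) *ᵥ vkron u v = vkron (A *ᵥ u) (B *ᵥ v) := by
  ext i
  simp only [mulVec, dotProduct, vkron, kroneckerMap_apply, Fintype.sum_prod_type,
    Finset.sum_mul_sum]
  exact Finset.sum_congr rfl fun _ _ => Finset.sum_congr rfl fun _ _ => by ring

/-- Lemma 1, eq. (34):
`(d ⊗ J_pᵀ ⊗ A) x = (I_M ⊗ X_pᵀ ⊗ I_{N_R}) (d ⊗ a_T ⊗ a_R)`,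
where `A = a_R a_Tᵀ`, `vec(X) = x` and `X_p = X J_p`. -/
theorem stmt0 (M L nT nR : ℕ) (hM : 0 < M) (hL : 0 < L) (hT : 0 < nT) (hR : 0 < nR)
    (p : ℤ) (d : Fin M → ℂ) (aT : Fin nT → ℂ) (aR : Fin nR → ℂ)
    (A : Matrix (Fin nR) (Fin nT) ℂ) (hA : A = Matrix.vecMulVec aR aT)
    (x : Fin L × Fin nT → ℂ) (X : Matrix (Fin nT) (Fin L) ℂ)
    (hX : ∀ q : Fin L × Fin nT, X q.2 q.1 = x q)
    (Xp : Matrix (Fin nT) (Fin L) ℂ) (hXp : Xp = X * shiftJ L p) :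
    -- LHS : the matrix `d ⊗ J_pᵀ ⊗ A` (with `d` a column vector) applied to `x`
    (fun i : Fin M × Fin L × Fin nR =>
        d i.1 * (((shiftJ L p)ᵀ ⊗ₖ A).mulVec x) i.2) =
    -- RHS : `(I_M ⊗ X_pᵀ ⊗ I_{N_R}) (d ⊗ a_T ⊗ a_R)`
    ((1 : Matrix (Fin M) (Fin M) ℂ) ⊗ₖ (Xpᵀ ⊗ₖ (1 : Matrix (Fin nR) (Fin nR) ℂ))).mulVec
      (vkron d (vkron aT aR)) := by
  rw [kronecker_mulVec_vkron, kronecker_mulVec_vkron, one_mulVec, one_mulVec]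
  subst hA hXp
  ext ⟨m, j, r⟩
  simp only [vkron, mulVec, dotProduct, kroneckerMap_apply, transpose_apply, mul_apply,
    vecMulVec_apply, Fintype.sum_prod_type, ← hX, Finset.sum_mul]
  rw [Finset.sum_comm]
  congr 1
  exact Finset.sum_congr rfl fun _ _ => Finset.sum_congr rfl fun _ _ => by ring
end

section
/- Let M, L, N_T, N_R be positive integers and let p be an integer. Let d ∈ ℂ^M, a_T ∈ ℂ^{N_T}, a_R ∈ ℂ^{N_R}, and set A = a_R a_T^T ∈ ℂ^{N_R×N_T}. Let K ∈ ℂ^{L N_R × L N_R} be the commutation matrix. Let w ∈ ℂ^{L M N_R} and let Ŵ ∈ ℂ^{L × M N_R} be the unique matrix with vec(Ŵ) = (I_M ⊗ K) w. Then (d^H ⊗ J_p ⊗ A^H) w = (J_p Ŵ ⊗ I_{N_T}) (conj(d) ⊗ conj(a_R) ⊗ conj(a_T)). -/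
open Matrix
open scoped Kronecker

/-- The `L N_R × L N_R` commutation matrix `K`: it satisfies `K vec(M) = vec(Mᵀ)` for every
`M ∈ ℂ^{N_R × L}`, where `vec` stacks columns (so `vec(M)` is indexed by
`Fin L × Fin nR` and `vec(Mᵀ)` by `Fin nR × Fin L`). -/
def commK (L nR : ℕ) : Matrix (Fin nR × Fin L) (Fin L × Fin nR) ℂ :=
  fun q q' => if q'.1 = q.2 ∧ q'.2 = q.1 then 1 else 0

/-- The matrix `I ⊗ K`, with `K` a commutation matrix, swaps the last two indices of a vector. -/
theorem one_kronecker_commK_mulVec {M L nR : ℕ} (w : Fin M × Fin L × Fin nR → ℂ)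
    (m : Fin M) (r : Fin nR) (l : Fin L) :
    (((1 : Matrix (Fin M) (Fin M) ℂ) ⊗ₖ commK L nR).mulVec w) (m, (r, l)) = w (m, l, r) := by
  simp only [mulVec, dotProduct, kroneckerMap_apply, commK]
  rw [Finset.sum_eq_single (m, l, r)]
  · simp
  · rintro ⟨m', l', r'⟩ - h
    by_cases hm : m = m'
    · subst hm
      have : ¬(l' = l ∧ r' = r) := fun ⟨hl, hr⟩ => h (by rw [hl, hr])
      simp [this]
    · simp [hm]
  · simp

/-- Lemma 1, eq. (35):
`(dᴴ ⊗ J_p ⊗ Aᴴ) w = (J_p Ŵ ⊗ I_{N_T}) (conj d ⊗ conj a_R ⊗ conj a_T)`,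
where `A = a_R a_Tᵀ` and `vec(Ŵ) = (I_M ⊗ K) w` with `K` the commutation matrix. -/
theorem stmt1 (M L nT nR : ℕ) (hM : 0 < M) (hL : 0 < L) (hT : 0 < nT) (hR : 0 < nR)
    (p : ℤ) (d : Fin M → ℂ) (aT : Fin nT → ℂ) (aR : Fin nR → ℂ)
    (A : Matrix (Fin nR) (Fin nT) ℂ) (hA : A = Matrix.vecMulVec aR aT)
    (w : Fin M × Fin L × Fin nR → ℂ)
    (What : Matrix (Fin L) (Fin M × Fin nR) ℂ)
    (hW : ∀ (m : Fin M) (r : Fin nR) (l : Fin L),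
      What l (m, r) =
        (((1 : Matrix (Fin M) (Fin M) ℂ) ⊗ₖ commK L nR).mulVec w) (m, (r, l))) :
    -- LHS : the matrix `dᴴ ⊗ J_p ⊗ Aᴴ` (with `dᴴ` a row vector) applied to `w`
    (Matrix.of fun (q : Fin L × Fin nT) (j : Fin M × Fin L × Fin nR) =>
        star (d j.1) * (shiftJ L p ⊗ₖ Aᴴ) q j.2).mulVec w =
    -- RHS : `(J_p Ŵ ⊗ I_{N_T}) (conj d ⊗ conj a_R ⊗ conj a_T)`
    ((shiftJ L p * What) ⊗ₖ (1 : Matrix (Fin nT) (Fin nT) ℂ)).mulVec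
      (vkron (vkron (fun m => star (d m)) (fun r => star (aR r))) (fun t => star (aT t))) := by
  simp only [one_kronecker_commK_mulVec] at hW
  subst hA
  ext ⟨l, t⟩
  simp only [mulVec, dotProduct, of_apply, kroneckerMap_apply, conjTranspose_apply,
    vecMulVec_apply, mul_apply, one_apply, vkron, Fintype.sum_prod_type, hW, star_mul', mul_ite,
    ite_mul, mul_one, mul_zero, zero_mul, Finset.sum_ite_eq, Finset.mem_univ, if_true,
    Finset.sum_mul]
  refine Finset.sum_congr rfl fun m _ => ?_
  rw [Finset.sum_comm]
  refine Finset.sum_congr rfl fun r _ => Finset.sum_congr rfl fun l' _ => ?_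
  ring
end

section
/- Let m, n, r be positive integers, K a finite index set, σ_k² ≥ 0 real numbers and V_k ∈ ℂ^{m×n} matrices for k ∈ K, V_t ∈ ℂ^{m×n}, and R_Jn ∈ ℂ^{m×m} Hermitian. Let e_t > 0, let w ∈ ℂ^m, and let U ∈ ℂ^{r×n} satisfy tr(U U^H) = e_t. Define R_u(U) = Σ_{k∈K} σ_k² V_k U^H U V_k^H + R_Jn, β(w) = (w^H R_Jn w)/e_t, Q_t(w) = V_t^H w w^H V_t, and R_u(w) = Σ_{k∈K} σ_k² V_k^H w w^H V_k + β(w) I_n. Then w^H V_t U^H U V_t^H w = tr(U Q_t(w) U^H) and w^H R_u(U) w = tr(U R_u(w) U^H); consequently, whenever w^H R_u(U) w ≠ 0, the SINR ratio satisfies (w^H V_t U^H U V_t^H w)/(w^H R_u(U) w) = tr(U Q_t(w) U^H)/tr(U R_u(w) U^H). -/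
open Matrix

theorem dotProduct_mulVec_eq_trace_mul_vecMulVec {ι R : Type*} [Fintype ι] [CommSemiring R]
    (M : Matrix ι ι R) (v w : ι → R) :
    v ⬝ᵥ M *ᵥ w = (M * vecMulVec w v).trace := by
  rw [mul_vecMulVec, trace_vecMulVec, dotProduct_comm]

theorem star_dotProduct_mulVec_eq_trace {ι κ ρ R : Type*} [Fintype ι] [Fintype κ] [Fintype ρ]
    [CommSemiring R] [StarRing R] (A : Matrix ι κ R) (U : Matrix ρ κ R) (w : ι → R) :
    star w ⬝ᵥ (A * Uᴴ * U * Aᴴ) *ᵥ w =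
      (U * (Aᴴ * vecMulVec w (star w) * A) * Uᴴ).trace := by
  rw [dotProduct_mulVec_eq_trace_mul_vecMulVec]
  simp only [Matrix.mul_assoc]
  rw [← Matrix.mul_assoc A, trace_mul_comm]
  simp only [Matrix.mul_assoc]

/-- Appendix A: with `R_u(U) = Σ_k σ_k² V_k Uᴴ U V_kᴴ + R_Jn`,
`β(w) = (wᴴ R_Jn w)/e_t`, `Q_t(w) = V_tᴴ w wᴴ V_t`, and
`R_u(w) = Σ_k σ_k² V_kᴴ w wᴴ V_k + β(w) I_n`, one has
`wᴴ V_t Uᴴ U V_tᴴ w = tr(U Q_t(w) Uᴴ)` and `wᴴ R_u(U) w = tr(U R_u(w) Uᴴ)`, and hence the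
equality of the two SINR ratios whenever the denominator is nonzero. -/
theorem stmt4 (m n r : ℕ) (hm : 0 < m) (hn : 0 < n) (hr : 0 < r)
    (K : Type*) [Fintype K]
    (σsq : K → ℝ) (hσ : ∀ k, 0 ≤ σsq k)
    (V : K → Matrix (Fin m) (Fin n) ℂ)
    (Vt : Matrix (Fin m) (Fin n) ℂ)
    (RJn : Matrix (Fin m) (Fin m) ℂ) (hRJn : RJn.IsHermitian)
    (et : ℝ) (het : 0 < et)
    (w : Fin m → ℂ)
    (U : Matrix (Fin r) (Fin n) ℂ) (hU : (U * Uᴴ).trace = (et : ℂ))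
    (RuU : Matrix (Fin m) (Fin m) ℂ)
    (hRuU : RuU = ∑ k : K, (σsq k : ℂ) • (V k * Uᴴ * U * (V k)ᴴ) + RJn)
    (β : ℂ) (hβ : β = (star w ⬝ᵥ RJn.mulVec w) / (et : ℂ))
    (Qtw : Matrix (Fin n) (Fin n) ℂ)
    (hQtw : Qtw = Vtᴴ * Matrix.vecMulVec w (star w) * Vt)
    (Ruw : Matrix (Fin n) (Fin n) ℂ)
    (hRuw : Ruw = ∑ k : K, (σsq k : ℂ) • ((V k)ᴴ * Matrix.vecMulVec w (star w) * V k) +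
      β • (1 : Matrix (Fin n) (Fin n) ℂ)) :
    star w ⬝ᵥ (Vt * Uᴴ * U * Vtᴴ).mulVec w = (U * Qtw * Uᴴ).trace ∧
    star w ⬝ᵥ RuU.mulVec w = (U * Ruw * Uᴴ).trace ∧
    (star w ⬝ᵥ RuU.mulVec w ≠ 0 →
      (star w ⬝ᵥ (Vt * Uᴴ * U * Vtᴴ).mulVec w) / (star w ⬝ᵥ RuU.mulVec w) =
        (U * Qtw * Uᴴ).trace / (U * Ruw * Uᴴ).trace) := by
  have hdenom : star w ⬝ᵥ RuU *ᵥ w = (U * Ruw * Uᴴ).trace := by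
    have het' : (et : ℂ) ≠ 0 := by exact_mod_cast het.ne'
    rw [hRuU, hRuw, add_mulVec, dotProduct_add, Matrix.mul_add, Matrix.add_mul, trace_add]
    congr 1
    · simp only [sum_mulVec, dotProduct_sum, Matrix.mul_sum, Matrix.sum_mul, trace_sum,
        smul_mulVec, dotProduct_smul, Matrix.mul_smul, Matrix.smul_mul, trace_smul,
        star_dotProduct_mulVec_eq_trace]
    · rw [Matrix.mul_smul, Matrix.mul_one, Matrix.smul_mul, trace_smul, hU, hβ, smul_eq_mul,
        div_mul_cancel₀ _ het']
  have hnum : star w ⬝ᵥ (Vt * Uᴴ * U * Vtᴴ) *ᵥ w = (U * Qtw * Uᴴ).trace := by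
    rw [hQtw, star_dotProduct_mulVec_eq_trace]
  exact ⟨hnum, hdenom, fun _ => by rw [hnum, hdenom]⟩
end

section
/- Let n, r be positive integers, let K ∈ ℂ^{n×n} be Hermitian, let k_min be the smallest eigenvalue of K, and set K_pos = K − k_min I_n (so K_pos is Hermitian positive semidefinite). Let e_t > 0 and let U, U_j ∈ ℂ^{r×n} satisfy tr(U U^H) = tr(U_j U_j^H) = e_t. Then tr(U K U^H) ≥ 2 Re(tr(U_j K_pos U^H)) + 2 k_min e_t − tr(U_j K U_j^H), with equality when U = U_j. -/
open Matrix
open scoped ComplexOrder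

/-- A Hermitian matrix minus a real lower bound of its eigenvalues is positive semidefinite. -/
theorem Matrix.IsHermitian.posSemidef_sub_smul_one {ι : Type*} [Fintype ι] [DecidableEq ι]
    {K : Matrix ι ι ℂ} (hK : K.IsHermitian) {c : ℝ} (hc : ∀ i, c ≤ hK.eigenvalues i) :
    (K - (c : ℂ) • (1 : Matrix ι ι ℂ)).PosSemidef := by
  set V : Matrix ι ι ℂ := hK.eigenvectorUnitary.1
  have hV : V * Vᴴ = 1 := Unitary.coe_mul_star_self hK.eigenvectorUnitary
  have hspec : K = V * diagonal (fun i => (hK.eigenvalues i : ℂ)) * Vᴴ := hK.spectral_theorem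
  have key : K - (c : ℂ) • (1 : Matrix ι ι ℂ) =
      V * diagonal (fun i => ((hK.eigenvalues i - c : ℝ) : ℂ)) * Vᴴ := by
    have hdiag : diagonal (fun i => ((hK.eigenvalues i - c : ℝ) : ℂ)) =
        diagonal (fun i => (hK.eigenvalues i : ℂ)) - (c : ℂ) • (1 : Matrix ι ι ℂ) := by
      rw [smul_one_eq_diagonal, diagonal_sub]
      simp
    rw [hdiag, Matrix.mul_sub, Matrix.sub_mul, ← hspec]
    simp [hV]
  rw [key]
  refine PosSemidef.mul_mul_conjTranspose_same (PosSemidef.diagonal fun i => ?_) V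
  simpa using hc i

/-- Expansion of the real quadratic form `tr(U B Uᴴ)` at a difference, for `B` Hermitian. -/
theorem Matrix.IsHermitian.re_trace_sub_mul_mul_conjTranspose_sub {ι κ : Type*} [Fintype ι]
    [Fintype κ] {B : Matrix ι ι ℂ} (hB : B.IsHermitian) (U W : Matrix κ ι ℂ) :
    ((U - W) * B * (U - W)ᴴ).trace.re =
      (U * B * Uᴴ).trace.re + (W * B * Wᴴ).trace.re - 2 * (W * B * Uᴴ).trace.re := by
  have hcross : (U * B * Wᴴ).trace.re = (W * B * Uᴴ).trace.re := by
    have h : U * B * Wᴴ = (W * B * Uᴴ)ᴴ := by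
      simp [conjTranspose_mul, hB.eq, Matrix.mul_assoc]
    rw [h, trace_conjTranspose]
    simp
  simp only [conjTranspose_sub, Matrix.sub_mul, Matrix.mul_sub, trace_sub, Complex.sub_re, hcross]
  ring

/-- the minorization inequality (29): for Hermitian `K` with smallest
eigenvalue `k_min` and `K_pos = K − k_min I`, and `U, U_j` with
`tr(U Uᴴ) = tr(U_j U_jᴴ) = e_t`, one has
`tr(U K Uᴴ) ≥ 2 Re(tr(U_j K_pos Uᴴ)) + 2 k_min e_t − tr(U_j K U_jᴴ)`,
with equality when `U = U_j`. -/
theorem stmt5 (n r : ℕ) (hn : 0 < n) (hr : 0 < r)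
    (K : Matrix (Fin n) (Fin n) ℂ) (hK : K.IsHermitian)
    (kmin : ℝ) (hkmin : IsLeast (Set.range hK.eigenvalues) kmin)
    (Kpos : Matrix (Fin n) (Fin n) ℂ)
    (hKpos : Kpos = K - (kmin : ℂ) • (1 : Matrix (Fin n) (Fin n) ℂ))
    (et : ℝ) (het : 0 < et)
    (U Uj : Matrix (Fin r) (Fin n) ℂ)
    (hU : (U * Uᴴ).trace = (et : ℂ)) (hUj : (Uj * Ujᴴ).trace = (et : ℂ)) :
    2 * (Uj * Kpos * Uᴴ).trace.re + 2 * kmin * et - (Uj * K * Ujᴴ).trace.re ≤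
      (U * K * Uᴴ).trace.re ∧
    (U = Uj →
      (U * K * Uᴴ).trace.re =
        2 * (Uj * Kpos * Uᴴ).trace.re + 2 * kmin * et - (Uj * K * Ujᴴ).trace.re) := by
  have hpsd : Kpos.PosSemidef :=
    hKpos ▸ hK.posSemidef_sub_smul_one fun i => hkmin.2 ⟨i, rfl⟩
  have hshift (W : Matrix (Fin r) (Fin n) ℂ) (hW : (W * Wᴴ).trace = (et : ℂ)) :
      (W * Kpos * Wᴴ).trace.re = (W * K * Wᴴ).trace.re - kmin * et := by
    simp [hKpos, Matrix.mul_sub, Matrix.sub_mul, trace_sub, hW]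
  have hUs := hshift U hU
  have hUjs := hshift Uj hUj
  constructor
  · have hnonneg : 0 ≤ ((U - Uj) * Kpos * (U - Uj)ᴴ).trace.re :=
      (Complex.le_def.1 (hpsd.mul_mul_conjTranspose_same (U - Uj)).trace_nonneg).1
    rw [hpsd.isHermitian.re_trace_sub_mul_mul_conjTranspose_sub] at hnonneg
    linarith
  · rintro rfl
    linarith
end

section
/- Let n be a positive integer, p_s > 0, let Q ∈ ℂ^{n×n} be Hermitian, and let R ∈ ℂ^{n×n} be Hermitian positive definite. Define the feasible sets F₁ = {R_s ∈ ℂ^{n×n} : R_s Hermitian positive semidefinite, diag(R_s) = p_s·1_n} and F₂ = {(M, η) : M ∈ ℂ^{n×n} Hermitian positive semidefinite, η ∈ ℝ, η > 0, diag(M) = η p_s·1_n, tr(M R) = 1}. Then tr(R_s R) > 0 for every R_s ∈ F₁, and if (M*, η*) maximizes tr(M Q) over F₂, then R_s* = M*/η* maximizes the fractional objective tr(R_s Q)/tr(R_s R) over F₁ (Charnes–Cooper transform equivalence). -/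
open Matrix
open scoped ComplexOrder

open scoped MatrixOrder in
theorem Matrix.PosDef.trace_mul_pos {m 𝕜 : Type*} [Fintype m] [RCLike 𝕜]
    {P R : Matrix m m 𝕜} (hR : R.PosDef) (hP : P.PosSemidef) (hP0 : P ≠ 0) :
    0 < (P * R).trace := by
  classical
  obtain ⟨S, hS⟩ := CStarAlgebra.nonneg_iff_eq_star_mul_self.mp hP.nonneg
  obtain ⟨B, hB⟩ := CStarAlgebra.nonneg_iff_eq_star_mul_self.mp hR.posSemidef.nonneg
  rw [star_eq_conjTranspose] at hS hB
  have htr : (P * R).trace = ((B * Sᴴ)ᴴ * (B * Sᴴ)).trace := by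
    rw [hS, hB, conjTranspose_mul, conjTranspose_conjTranspose, Matrix.mul_assoc,
      trace_mul_comm]
    simp only [Matrix.mul_assoc]
  rw [htr]
  refine (posSemidef_conjTranspose_mul_self (B * Sᴴ)).trace_nonneg.lt_of_ne' fun h => hP0 ?_
  have hBS : B * Sᴴ = 0 := trace_conjTranspose_mul_self_eq_zero_iff.mp h
  have hRS : R * Sᴴ = 0 := by rw [hB, Matrix.mul_assoc, hBS, Matrix.mul_zero]
  rw [hS, hR.isUnit.mul_right_eq_zero.mp hRS, Matrix.zero_mul]

/-- Charnes–Cooper transform equivalence between (37) and (38):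
with `F₁ = {R_s ⪰ 0 : diag(R_s) = p_s·1}` and
`F₂ = {(M, η) : M ⪰ 0, η > 0, diag(M) = η p_s·1, tr(M R) = 1}`, every `R_s ∈ F₁` has
`tr(R_s R) > 0`, and if `(M*, η*)` maximizes `tr(M Q)` over `F₂`, then `R_s* = M*/η*`
maximizes `tr(R_s Q)/tr(R_s R)` over `F₁`. -/
theorem stmt11 (n : ℕ) (hn : 0 < n) (ps : ℝ) (hps : 0 < ps)
    (Q : Matrix (Fin n) (Fin n) ℂ) (hQ : Q.IsHermitian)
    (R : Matrix (Fin n) (Fin n) ℂ) (hR : R.PosDef) :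
    (∀ Rs : Matrix (Fin n) (Fin n) ℂ, Rs.PosSemidef → (∀ i, Rs i i = (ps : ℂ)) →
      0 < (Rs * R).trace.re) ∧
    (∀ (Mst : Matrix (Fin n) (Fin n) ℂ) (ηst : ℝ),
      -- (M*, η*) is feasible for F₂
      Mst.PosSemidef → 0 < ηst → (∀ i, Mst i i = ((ηst * ps : ℝ) : ℂ)) →
      (Mst * R).trace = 1 →
      -- (M*, η*) maximizes tr(M Q) over F₂
      (∀ (M' : Matrix (Fin n) (Fin n) ℂ) (η' : ℝ),
        M'.PosSemidef → 0 < η' → (∀ i, M' i i = ((η' * ps : ℝ) : ℂ)) →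
        (M' * R).trace = 1 → (M' * Q).trace.re ≤ (Mst * Q).trace.re) →
      -- then R_s* = M*/η* is feasible for F₁ and maximizes the fractional objective
      ((((ηst⁻¹ : ℝ) : ℂ) • Mst).PosSemidef ∧
        (∀ i, (((ηst⁻¹ : ℝ) : ℂ) • Mst) i i = (ps : ℂ)) ∧
        (∀ Rs : Matrix (Fin n) (Fin n) ℂ, Rs.PosSemidef → (∀ i, Rs i i = (ps : ℂ)) →
          (Rs * Q).trace.re / (Rs * R).trace.re ≤
            ((((ηst⁻¹ : ℝ) : ℂ) • Mst) * Q).trace.re /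
              ((((ηst⁻¹ : ℝ) : ℂ) • Mst) * R).trace.re))) := by
  have htr : ∀ Rs : Matrix (Fin n) (Fin n) ℂ, Rs.PosSemidef → (∀ i, Rs i i = (ps : ℂ)) →
      0 < (Rs * R).trace := fun Rs hRs hd => hR.trace_mul_pos hRs fun h0 => by
    have h := hd ⟨0, hn⟩
    rw [h0, Matrix.zero_apply] at h
    exact hps.ne (by exact_mod_cast h)
  refine ⟨fun Rs hRs hd => (Complex.lt_def.mp (htr Rs hRs hd)).1, ?_⟩
  intro M η hM hη hMd hMR hmax
  refine ⟨hM.smul (by exact_mod_cast (inv_pos.mpr hη).le), fun i => ?_, fun Rs hRs hd => ?_⟩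
  · rw [Matrix.smul_apply, hMd, smul_eq_mul, ← Complex.ofReal_mul, inv_mul_cancel_left₀ hη.ne']
  · obtain ⟨ht, hti⟩ := Complex.lt_def.mp (htr Rs hRs hd)
    set t := (Rs * R).trace.re
    have htc : (Rs * R).trace = (t : ℂ) := Complex.ext rfl hti.symm
    have ht0 : 0 < t := ht
    have hle := hmax (((t⁻¹ : ℝ) : ℂ) • Rs) t⁻¹
      (hRs.smul (by exact_mod_cast (inv_pos.mpr ht0).le)) (inv_pos.mpr ht0)
      (fun i => by rw [Matrix.smul_apply, hd, smul_eq_mul, ← Complex.ofReal_mul])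
      (by rw [smul_mul, trace_smul, htc, smul_eq_mul, ← Complex.ofReal_mul,
            inv_mul_cancel₀ ht0.ne', Complex.ofReal_one])
    rw [smul_mul, trace_smul, smul_eq_mul, Complex.re_ofReal_mul] at hle
    rw [smul_mul, smul_mul, trace_smul, trace_smul, hMR, smul_eq_mul, smul_eq_mul,
      Complex.re_ofReal_mul, Complex.re_ofReal_mul, Complex.one_re, mul_one,
      mul_div_cancel_left₀ _ (inv_pos.mpr hη).ne', div_eq_inv_mul]
    exact hle
end
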